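/- Let f ∈ F be convex, let (x,t) ∈ (0,∞)ⁿ × [0,T] and let v ∈ ℝⁿ \ {0} be a direction with ∂_v²f(x) = 0. Then ∂_v²(Bf)(x,t) = λ(t) ∫₀¹ ( f_vv(x+φ) + 2 φ_v·∇f_v(x+φ) + φ_vᵀ Hf(x+φ) φ_v + φ_vv·(∇f(x+φ) − ∇f(x)) ) dz, where φ = φ(x,t,z), φ_v and φ_vv denote the first and second directional x-derivatives of φ in direction v, f_v = ∂_v f, f_vv = ∂_v² f, and Hf is the Hessian of f. -/

import Mathlib

open MeasureTheory Set Matrix NNReal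

noncomputable section

/-- The open positive orthant `(0,∞)ⁿ` in `ℝⁿ`. -/
def posOrth (n : ℕ) : Set (Fin n → ℝ) := {x | ∀ i, 0 < x i}

/-- First directional derivative of `f` at `x` in direction `v`. -/
def dir1 {n : ℕ} {F : Type*} [NormedAddCommGroup F] [NormedSpace ℝ F]
    (f : (Fin n → ℝ) → F) (x v : Fin n → ℝ) : F :=
  fderiv ℝ f x v

/-- Mixed second derivative: differentiate `f` in direction `v`, then in direction `w`. -/
def dmix {n : ℕ} {F : Type*} [NormedAddCommGroup F] [NormedSpace ℝ F]
    (f : (Fin n → ℝ) → F) (x v w : Fin n → ℝ) : F :=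
  fderiv ℝ (fun y => fderiv ℝ f y v) x w

/-- Second directional derivative of `f` at `x` in direction `v`. -/
def dir2 {n : ℕ} {F : Type*} [NormedAddCommGroup F] [NormedSpace ℝ F]
    (f : (Fin n → ℝ) → F) (x v : Fin n → ℝ) : F :=
  dmix f x v v

/-- The class `F` of test functions: `C⁴` on the positive orthant, with locally Hölder
continuous fourth derivatives, and with `f` together with its derivatives up to order two
of at most polynomial growth. -/
structure MemTestClass (n : ℕ) (f : (Fin n → ℝ) → ℝ) : Prop where
  smooth : ContDiffOn ℝ 4 f (posOrth n)
  holder4 : ∃ α : ℝ≥0, 0 < α ∧ (α : ℝ) ≤ 1 ∧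
    ∀ x ∈ posOrth n, ∃ s ∈ nhds x, s ⊆ posOrth n ∧
      ∃ C : ℝ≥0, HolderOnWith C α (iteratedFDeriv ℝ 4 f) s
  polyGrowth : ∃ C m : ℝ, ∀ x ∈ posOrth n, ∀ k : ℕ, k ≤ 2 →
    ‖iteratedFDeriv ℝ k f x‖ ≤ C * (1 + ‖x‖ ^ m)

/-- The jump structure `φ(x,t,z)` together with the standing assumptions (A3), (A6), (A7). -/
structure JumpKernel (n : ℕ) (T : ℝ) where
  φ : (Fin n → ℝ) → ℝ → ℝ → (Fin n → ℝ)
  meas : ∀ x ∈ posOrth n, ∀ t ∈ Icc (0:ℝ) T, Measurable (fun z => φ x t z)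
  smooth : ∀ t ∈ Icc (0:ℝ) T, ∀ z ∈ Icc (0:ℝ) 1,
    ContDiffOn ℝ 2 (fun x => φ x t z) (posOrth n)
  holder2 : ∃ α : ℝ≥0, 0 < α ∧ (α : ℝ) ≤ 1 ∧
    ∀ t ∈ Icc (0:ℝ) T, ∀ x ∈ posOrth n, ∃ s ∈ nhds x, s ⊆ posOrth n ∧
      ∃ C : ℝ≥0, ∀ z ∈ Icc (0:ℝ) 1,
        HolderOnWith C α (iteratedFDeriv ℝ 2 (fun y => φ y t z)) s
  bound : ∃ D : ℝ, 0 < D ∧ ∀ x ∈ posOrth n, ∀ t ∈ Icc (0:ℝ) T, ∀ z ∈ Icc (0:ℝ) 1,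
    ∀ i, (φ x t z i) ^ 2 ≤ D * (x i) ^ 2
  lower : ∃ γ₀ : ℝ, -1 < γ₀ ∧ ∀ x ∈ posOrth n, ∀ t ∈ Icc (0:ℝ) T, ∀ z ∈ Icc (0:ℝ) 1,
    ∀ i, γ₀ * x i < φ x t z i

/-- For each fixed `(x,t)`, `φ(x,t,z) ≠ 0` for almost every `z ∈ [0,1]`. -/
def JumpKernel.AENonzero {n : ℕ} {T : ℝ} (K : JumpKernel n T) : Prop :=
  ∀ x ∈ posOrth n, ∀ t ∈ Icc (0:ℝ) T,
    ∀ᵐ z ∂(volume.restrict (Icc (0:ℝ) 1)), K.φ x t z ≠ 0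

/-- The jump intensity `λ` : nonnegative and Hölder continuous on `[0,T]`. -/
def LamOK (T : ℝ) (lam : ℝ → ℝ) : Prop :=
  (∀ t ∈ Icc (0:ℝ) T, 0 ≤ lam t) ∧
  ∃ α C : ℝ≥0, 0 < α ∧ (α : ℝ) ≤ 1 ∧ HolderOnWith C α lam (Icc (0:ℝ) T)

/-- The integro-differential jump operator `B`. -/
def Bop {n : ℕ} {T : ℝ} (lam : ℝ → ℝ) (K : JumpKernel n T)
    (f : (Fin n → ℝ) → ℝ) (x : Fin n → ℝ) (t : ℝ) : ℝ :=
  lam t * ∫ z in Icc (0:ℝ) 1,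
    (f (x + K.φ x t z) - f x - fderiv ℝ f x (K.φ x t z))

/-- The diffusion matrix `β(x,t)` together with the standing assumptions (A1), (A3), (A5). -/
structure DiffKernel (n : ℕ) (T : ℝ) where
  β : (Fin n → ℝ) → ℝ → Matrix (Fin n) (Fin n) ℝ
  smooth : ∀ t ∈ Icc (0:ℝ) T, ∀ i j, ContDiffOn ℝ 2 (fun x => β x t i j) (posOrth n)
  holder2 : ∃ α : ℝ≥0, 0 < α ∧ (α : ℝ) ≤ 1 ∧
    ∀ t ∈ Icc (0:ℝ) T, ∀ i j, ∀ x ∈ posOrth n, ∃ s ∈ nhds x, s ⊆ posOrth n ∧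
      ∃ C : ℝ≥0, HolderOnWith C α (iteratedFDeriv ℝ 2 (fun y => β y t i j)) s
  nonsing : ∀ x ∈ posOrth n, ∀ t ∈ Icc (0:ℝ) T, (β x t).det ≠ 0
  bound : ∃ D : ℝ, 0 < D ∧ ∀ x ∈ posOrth n, ∀ t ∈ Icc (0:ℝ) T,
    ∀ i, ∑ j, (β x t i j) ^ 2 ≤ D * (x i) ^ 2

/-- The second order differential operator `A` with coefficient matrix `a = ββ*/2`. -/
def Aop {n : ℕ} {T : ℝ} (Dk : DiffKernel n T)
    (f : (Fin n → ℝ) → ℝ) (x : Fin n → ℝ) (t : ℝ) : ℝ :=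
  ∑ i, ∑ j, ((Dk.β x t * (Dk.β x t)ᵀ) i j / 2) *
    dmix f x (Pi.single i 1) (Pi.single j 1)

/-- An operator `D` (mapping a test function `f` to a function of `(x,t)`) is locally
convexity preserving (LCP) at `(x,t)` if `∂_v²(Df)(x,t) ≥ 0` for every direction `v ≠ 0`
and every convex `f ∈ F` with `∂_v²f(x) = 0`. -/
def IsLCPAt {n : ℕ} (D : ((Fin n → ℝ) → ℝ) → (Fin n → ℝ) → ℝ → ℝ)
    (x : Fin n → ℝ) (t : ℝ) : Prop :=
  ∀ v : Fin n → ℝ, v ≠ 0 → ∀ f : (Fin n → ℝ) → ℝ,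
    MemTestClass n f → ConvexOn ℝ (posOrth n) f → dir2 f x v = 0 →
    0 ≤ dir2 (fun y => D f y t) x v

/-- The integrand in condition (ohly) of Theorem 5.1. -/
def ohlyIntegrand {n : ℕ} {T : ℝ} (K : JumpKernel n T)
    (f : (Fin n → ℝ) → ℝ) (x v : Fin n → ℝ) (t z : ℝ) : ℝ :=
  dmix f (x + K.φ x t z) v v
    + 2 * dmix f (x + K.φ x t z) v (dir1 (fun y => K.φ y t z) x v)
    + dmix f (x + K.φ x t z) (dir1 (fun y => K.φ y t z) x v)
        (dir1 (fun y => K.φ y t z) x v)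
    + (fderiv ℝ f (x + K.φ x t z) (dir2 (fun y => K.φ y t z) x v)
        - fderiv ℝ f x (dir2 (fun y => K.φ y t z) x v))


theorem norm_fderiv_le_of_oscillation {E F : Type*} [NormedAddCommGroup E] [NormedSpace ℝ E]
    [NormedAddCommGroup F] [NormedSpace ℝ F] {g : E → F} {g' : E → E →L[ℝ] F} {x : E}
    {r c M : ℝ} (hr : 0 < r) (hg : ∀ y ∈ Metric.ball x r, HasFDerivAt g (g' y) y)
    (hc : ∀ y ∈ Metric.ball x r, ‖g' y - g' x‖ ≤ c)
    (hM : ∀ y ∈ Metric.ball x r, ‖g y‖ ≤ M) :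
    ‖g' x‖ ≤ 4 * M / r + c := by
  have hx : x ∈ Metric.ball x r := Metric.mem_ball_self hr
  have hM0 : 0 ≤ M := (norm_nonneg _).trans (hM x hx)
  have hc0 : 0 ≤ c := (norm_nonneg _).trans (hc x hx)
  refine ContinuousLinearMap.opNorm_le_bound _ (by positivity) fun h => ?_
  rcases eq_or_ne h 0 with rfl | hh
  · simp
  have hn : 0 < ‖h‖ := norm_pos_iff.2 hh
  set a : ℝ := r / (2 * ‖h‖) with ha
  have ha0 : 0 < a := by positivity
  have hah : ‖a • h‖ = r / 2 := by
    rw [norm_smul, Real.norm_of_nonneg ha0.le, ha]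
    field_simp
  have hy : x + a • h ∈ Metric.ball x r := by
    rw [Metric.mem_ball, dist_eq_norm, add_sub_cancel_left, hah]
    linarith
  have key := (convex_ball x r).norm_image_sub_le_of_norm_hasFDerivWithin_le'
    (fun y hy => (hg y hy).hasFDerivWithinAt) hc hx hy
  rw [add_sub_cancel_left, hah, map_smul] at key
  have h1 : ‖a • g' x h‖ ≤ 2 * M + c * (r / 2) := by
    calc ‖a • g' x h‖
        = ‖g (x + a • h) - g x - (g (x + a • h) - g x - a • g' x h)‖ := by congr 1; abel
      _ ≤ ‖g (x + a • h)‖ + ‖g x‖ + ‖g (x + a • h) - g x - a • g' x h‖ :=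
          (norm_sub_le _ _).trans (add_le_add_left (norm_sub_le _ _) _)
      _ ≤ 2 * M + c * (r / 2) := by linarith [hM _ hy, hM _ hx]
  rw [norm_smul, Real.norm_of_nonneg ha0.le, ha, div_mul_eq_mul_div,
    div_le_iff₀ (by positivity)] at h1
  refine le_of_mul_le_mul_left (h1.trans_eq ?_) hr
  field_simp
  ring

theorem fderiv_bounds_of_oscillation {E F : Type*} [NormedAddCommGroup E] [NormedSpace ℝ E]
    [NormedAddCommGroup F] [NormedSpace ℝ F] {x : E} {r : ℝ} (hr : 0 < r) (c M : ℝ) :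
    ∃ L : ℝ, ∀ g : E → F, ContDiffOn ℝ 2 g (Metric.ball x r) →
      (∀ y ∈ Metric.ball x r, ‖g y‖ ≤ M) →
      (∀ y ∈ Metric.ball x r,
        ‖fderiv ℝ (fderiv ℝ g) y - fderiv ℝ (fderiv ℝ g) x‖ ≤ c) →
      ∀ y ∈ Metric.ball x (r / 2),
        ‖fderiv ℝ g y‖ ≤ L ∧ ‖fderiv ℝ (fderiv ℝ g) y‖ ≤ L := by
  set K : ℝ := 4 * (2 * M) / (r / 2) + c * r with hK
  set L₁ : ℝ := 4 * M / (r / 2) + K + K with hL₁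
  refine ⟨max L₁ (4 * L₁ / (r / 2) + c + c), fun g hg hM hc => ?_⟩
  have hsub : Metric.ball x (r / 2) ⊆ Metric.ball x r := Metric.ball_subset_ball (by linarith)
  have hr2 : 0 < r / 2 := by positivity
  have hx2 : x ∈ Metric.ball x (r / 2) := Metric.mem_ball_self hr2
  have hc0 : 0 ≤ c :=
    (norm_nonneg (fderiv ℝ (fderiv ℝ g) x - fderiv ℝ (fderiv ℝ g) x)).trans (hc x (hsub hx2))
  have hg1 : ∀ y ∈ Metric.ball x r, HasFDerivAt g (fderiv ℝ g y) y := fun y hy =>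
    ((hg.differentiableOn (by norm_num)).differentiableAt
      (Metric.isOpen_ball.mem_nhds hy)).hasFDerivAt
  have hg2 : ∀ y ∈ Metric.ball x r, HasFDerivAt (fderiv ℝ g) (fderiv ℝ (fderiv ℝ g) y) y :=
    fun y hy => (((hg.fderiv_of_isOpen Metric.isOpen_ball (m := 1) (by norm_num)).differentiableOn
      (by norm_num)).differentiableAt (Metric.isOpen_ball.mem_nhds hy)).hasFDerivAt
  have hadd : ∀ {y h : E}, y ∈ Metric.ball x (r / 2) → ‖h‖ < r / 2 → y + h ∈ Metric.ball x r := by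
    intro y h hy hh
    rw [Metric.mem_ball, dist_eq_norm] at hy ⊢
    calc ‖y + h - x‖ = ‖(y - x) + h‖ := by congr 1; abel
      _ ≤ ‖y - x‖ + ‖h‖ := norm_add_le _ _
      _ < r := by linarith
  have hosc : ∀ y ∈ Metric.ball x (r / 2), ‖fderiv ℝ g y - fderiv ℝ g x‖ ≤ K := by
    intro w hw
    obtain ⟨h, rfl⟩ : ∃ h, w = x + h := ⟨w - x, by abel⟩
    have hh : ‖h‖ < r / 2 := by simpa [dist_eq_norm] using hw
    have hA : ∀ y ∈ Metric.ball x (r / 2),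
        ‖fderiv ℝ g (y + h) - fderiv ℝ g y - fderiv ℝ (fderiv ℝ g) x h‖ ≤ c * ‖h‖ := by
      intro y hy
      have := (convex_ball x r).norm_image_sub_le_of_norm_hasFDerivWithin_le'
        (fun y hy => (hg2 y hy).hasFDerivWithinAt) hc (hsub hy) (hadd hy hh)
      simpa using this
    refine norm_fderiv_le_of_oscillation (g := fun y => g (y + h) - g y)
      (g' := fun y => fderiv ℝ g (y + h) - fderiv ℝ g y) hr2 (fun y hy => ?_)
      (fun y hy => ?_) (fun y hy => ?_)
    · exact ((hasFDerivAt_comp_add_right h).2 (hg1 _ (hadd hy hh))).sub (hg1 y (hsub hy))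
    · calc _ = ‖(fderiv ℝ g (y + h) - fderiv ℝ g y - fderiv ℝ (fderiv ℝ g) x h) -
            (fderiv ℝ g (x + h) - fderiv ℝ g x - fderiv ℝ (fderiv ℝ g) x h)‖ := by
            congr 1; abel
        _ ≤ c * ‖h‖ + c * ‖h‖ := (norm_sub_le _ _).trans (add_le_add (hA y hy) (hA x hx2))
        _ ≤ c * r := by nlinarith
    · exact (norm_sub_le _ _).trans (by linarith [hM _ (hadd hy hh), hM _ (hsub hy)])
  have hgx : ‖fderiv ℝ g x‖ ≤ 4 * M / (r / 2) + K :=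
    norm_fderiv_le_of_oscillation hr2 (fun y hy => hg1 y (hsub hy)) hosc
      (fun y hy => hM y (hsub hy))
  have hL : ∀ y ∈ Metric.ball x (r / 2), ‖fderiv ℝ g y‖ ≤ L₁ := fun y hy =>
    (norm_le_norm_add_norm_sub' _ _).trans (add_le_add hgx (hosc y hy))
  have hgxx : ‖fderiv ℝ (fderiv ℝ g) x‖ ≤ 4 * L₁ / (r / 2) + c :=
    norm_fderiv_le_of_oscillation hr2 (fun y hy => hg2 y (hsub hy))
      (fun y hy => hc y (hsub hy)) hL
  exact fun y hy => ⟨(hL y hy).trans (le_max_left _ _),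
    ((norm_le_norm_add_norm_sub' (fderiv ℝ (fderiv ℝ g) y) (fderiv ℝ (fderiv ℝ g) x)).trans
      (add_le_add hgxx (hc y (hsub hy)))).trans
      (le_max_right _ _)⟩

theorem fderiv_integral_apply {n : ℕ} {μ : Measure ℝ} [IsFiniteMeasure μ]
    {G : (Fin n → ℝ) → ℝ → ℝ} {U : Set (Fin n → ℝ)} (hU : IsOpen U) {C : ℝ}
    (hint : ∀ y ∈ U, Integrable (G y) μ)
    (hdiff : ∀ᵐ z ∂μ, ∀ y ∈ U, DifferentiableAt ℝ (fun y => G y z) y)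
    (hb : ∀ᵐ z ∂μ, ∀ y ∈ U, ‖fderiv ℝ (fun y => G y z) y‖ ≤ C)
    {y : Fin n → ℝ} (hy : y ∈ U) (w : Fin n → ℝ) :
    Integrable (fun z => fderiv ℝ (fun y => G y z) y w) μ ∧
      fderiv ℝ (fun y => ∫ z, G y z ∂μ) y w = ∫ z, fderiv ℝ (fun y => G y z) y w ∂μ := by
  have hmeas : ∀ w : Fin n → ℝ,
      AEStronglyMeasurable (fun z => fderiv ℝ (fun y => G y z) y w) μ := by
    intro w
    have hc : Filter.Tendsto (fun k : ℕ => ((k : ℝ) + 1)) Filter.atTop Filter.atTop :=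
      Filter.tendsto_atTop_add_const_right _ _ tendsto_natCast_atTop_atTop
    have hlim : Filter.Tendsto (fun k : ℕ => y + ((k : ℝ) + 1)⁻¹ • w) Filter.atTop (nhds y) := by
      have := ((tendsto_inv_atTop_zero.comp hc).smul_const w).const_add y
      simpa using this
    obtain ⟨N, hN⟩ := Filter.eventually_atTop.1 (hlim.eventually (hU.mem_nhds hy))
    refine aestronglyMeasurable_of_tendsto_ae Filter.atTop
      (f := fun (k : ℕ) (z : ℝ) => (((k + N : ℕ) : ℝ) + 1) •
        (G (y + (((k + N : ℕ) : ℝ) + 1)⁻¹ • w) z - G y z)) (fun k => ?_) ?_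
    · exact ((hint _ (hN _ (Nat.le_add_left _ _))).1.sub (hint _ hy).1).const_smul
        (((k + N : ℕ) : ℝ) + 1)
    · filter_upwards [hdiff] with z hz
      have := ((hz y hy).hasFDerivAt.lim_real w).comp hc
      exact this.comp (Filter.tendsto_add_atTop_nat N)
  have hmeas' : AEStronglyMeasurable (fun z => fderiv ℝ (fun y => G y z) y) μ := by
    have : (fun z => fderiv ℝ (fun y => G y z) y) = fun z => ∑ i : Fin n,
        (fderiv ℝ (fun y => G y z) y (Pi.single i 1)) •
          (ContinuousLinearMap.proj (R := ℝ) (φ := fun _ : Fin n => ℝ) i) := by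
      ext z v
      conv_lhs => rw [pi_eq_sum_univ' v]
      simp [map_sum, mul_comm]
    rw [this]
    exact Finset.aestronglyMeasurable_fun_sum _ fun i _ => (hmeas _).smul_const _
  have hbound : ∀ᵐ z ∂μ, ‖fderiv ℝ (fun y => G y z) y‖ ≤ C := hb.mono fun z hz => hz y hy
  have hint' : Integrable (fun z => fderiv ℝ (fun y => G y z) y) μ :=
    Integrable.of_bound hmeas' C hbound
  have main := hasFDerivAt_integral_of_dominated_of_fderiv_le (μ := μ) (F := G)
    (F' := fun y z => fderiv ℝ (fun y => G y z) y) (bound := fun _ => C) (hU.mem_nhds hy)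
    (Filter.eventually_of_mem (hU.mem_nhds hy) fun y hy => (hint y hy).1) (hint y hy) hmeas' hb
    (integrable_const _) (hdiff.mono fun z hz y hy => (hz y hy).hasFDerivAt)
  refine ⟨hint'.apply_continuousLinearMap w, ?_⟩
  rw [main.fderiv, ContinuousLinearMap.integral_apply hint']

theorem isOpen_posOrth (n : ℕ) : IsOpen (posOrth n) := by
  simp only [posOrth, ofPred_forall]
  exact isOpen_iInter_of_finite fun i => isOpen_lt continuous_const (continuous_apply i)

section SecondDerivative

variable {E F : Type*} [NormedAddCommGroup E] [NormedSpace ℝ E] [NormedAddCommGroup F]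
  [NormedSpace ℝ F] {U : Set E} {x : E}

theorem ContDiffOn.hasFDerivAt_fderiv {g : E → F} (hU : IsOpen U) (hg : ContDiffOn ℝ 2 g U)
    (hx : x ∈ U) : HasFDerivAt (fderiv ℝ g) (fderiv ℝ (fderiv ℝ g) x) x :=
  (((hg.fderiv_of_isOpen hU (m := 1) (by norm_num)).differentiableOn
    (by norm_num)).differentiableAt (hU.mem_nhds hx)).hasFDerivAt

theorem ContDiffOn.fderiv_fderiv_apply {g : E → F} (hU : IsOpen U) (hg : ContDiffOn ℝ 2 g U)
    (hx : x ∈ U) (v w : E) :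
    fderiv ℝ (fun y => fderiv ℝ g y v) x w = fderiv ℝ (fderiv ℝ g) x w v := by
  rw [((hg.hasFDerivAt_fderiv hU hx).clm_apply (hasFDerivAt_const v x)).fderiv]
  simp

theorem ContDiffOn.fderiv_fderiv_comm {g : E → F} (hU : IsOpen U) (hg : ContDiffOn ℝ 2 g U)
    (hx : x ∈ U) (v w : E) :
    fderiv ℝ (fderiv ℝ g) x v w = fderiv ℝ (fderiv ℝ g) x w v :=
  (hg.contDiffAt (hU.mem_nhds hx)).isSymmSndFDerivAt (by simp) v w

theorem ConvexOn.fderiv_fderiv_nonneg {f : E → ℝ} (hU : IsOpen U) (hconv : ConvexOn ℝ U f)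
    (hf : ContDiffOn ℝ 2 f U) (hx : x ∈ U) (v : E) :
    0 ≤ fderiv ℝ (fderiv ℝ f) x v v := by
  set ℓ : ℝ →ᵃ[ℝ] E := AffineMap.lineMap x (x + v) with hℓ
  have hℓ' : ∀ s, HasDerivAt ℓ v s := fun s => by
    simpa [hℓ] using AffineMap.hasDerivAt_lineMap (a := x) (b := x + v) (x := s)
  have hS : IsOpen (ℓ ⁻¹' U) :=
    hU.preimage (continuous_iff_continuousAt.2 fun s => (hℓ' s).continuousAt)
  have h0 : (0 : ℝ) ∈ ℓ ⁻¹' U := by simpa [hℓ] using hx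
  have hd : ∀ s ∈ ℓ ⁻¹' U, HasDerivAt (f ∘ ℓ) (fderiv ℝ f (ℓ s) v) s := fun s hs =>
    (((hf.differentiableOn (by norm_num)).differentiableAt
      (hU.mem_nhds hs)).hasFDerivAt).comp_hasDerivAt s (hℓ' s)
  have hmono := (hconv.comp_affineMap ℓ).monotoneOn_deriv fun s hs => (hd s hs).differentiableAt
  have h2 : HasDerivAt (deriv (f ∘ ℓ)) (fderiv ℝ (fderiv ℝ f) x v v) 0 := by
    have hx0 : ℓ 0 = x := by simp [hℓ]
    have h1 : HasFDerivAt (fderiv ℝ f) (fderiv ℝ (fderiv ℝ f) x) (ℓ 0) := by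
      rw [hx0]; exact hf.hasFDerivAt_fderiv hU hx
    have h3 := (h1.comp_hasDerivAt 0 (hℓ' 0)).clm_apply (hasDerivAt_const 0 v)
    simp only [map_zero, add_zero] at h3
    exact h3.congr_of_eventuallyEq
      (Filter.eventually_of_mem (hS.mem_nhds h0) fun s hs => (hd s hs).deriv)
  rw [← h2.deriv, ← derivWithin_of_isOpen hS h0]
  exact hmono.derivWithin_nonneg

theorem ConvexOn.fderiv_fderiv_eq_zero {f : E → ℝ} (hU : IsOpen U) (hconv : ConvexOn ℝ U f)
    (hf : ContDiffOn ℝ 2 f U) (hx : x ∈ U) {v : E} (hv : fderiv ℝ (fderiv ℝ f) x v v = 0)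
    (w : E) : fderiv ℝ (fderiv ℝ f) x w v = 0 := by
  have hsymm := hf.fderiv_fderiv_comm hU hx v w
  set Q := fderiv ℝ (fderiv ℝ f) x with hQ
  have h : ∀ s : ℝ, 0 ≤ Q w w + 2 * s * Q w v := fun s => by
    have := hconv.fderiv_fderiv_nonneg hU hf hx (w + s • v)
    rw [← hQ] at this
    simp only [map_add, map_smul, _root_.add_apply, _root_.smul_apply,
      smul_eq_mul, hv, hsymm] at this
    linarith
  by_contra hne
  have := h (-(Q w w + 1) / (2 * Q w v))
  field_simp at this
  linarith

theorem ConvexOn.fderiv_fderiv_fderiv_eq_zero {f : E → ℝ} (hU : IsOpen U)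
    (hconv : ConvexOn ℝ U f) (hf : ContDiffOn ℝ 3 f U) (hx : x ∈ U) {v : E}
    (hv : fderiv ℝ (fderiv ℝ f) x v v = 0) (w : E) :
    fderiv ℝ (fderiv ℝ fun y => fderiv ℝ f y v) x v w = 0 := by
  have hf2 : ContDiffOn ℝ 2 f U := hf.of_le (by norm_num)
  have hk : ContDiffOn ℝ 2 (fun y => fderiv ℝ f y v) U :=
    (hf.fderiv_of_isOpen hU (by norm_num)).clm_apply contDiffOn_const
  have hmin : IsLocalMin (fun y => fderiv ℝ (fun y => fderiv ℝ f y v) y v) x := by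
    filter_upwards [hU.mem_nhds hx] with y hy
    rw [hf2.fderiv_fderiv_apply hU hx, hf2.fderiv_fderiv_apply hU hy, hv]
    exact hconv.fderiv_fderiv_nonneg hU hf2 hy v
  rw [hk.fderiv_fderiv_comm hU hx, ← hk.fderiv_fderiv_apply hU hx, hmin.fderiv_eq_zero]
  simp

/-- The second directional derivative of the Taylor remainder `f (y + ψ y) - f y - Df(y) (ψ y)` of
a convex function `f`, in a direction along which `f` has no second order variation at `x`. -/
theorem ConvexOn.fderiv_fderiv_taylor_remainder {f : E → ℝ} {ψ : E → E} (hU : IsOpen U)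
    (hconv : ConvexOn ℝ U f) (hf : ContDiffOn ℝ 3 f U) (hψ : ContDiffOn ℝ 2 ψ U)
    (hmaps : ∀ y ∈ U, y + ψ y ∈ U) (hx : x ∈ U) {v : E}
    (hv : fderiv ℝ (fderiv ℝ f) x v v = 0) :
    fderiv ℝ (fun y => fderiv ℝ (fun y => f (y + ψ y) - f y - fderiv ℝ f y (ψ y)) y v) x v =
      fderiv ℝ (fderiv ℝ f) (x + ψ x) (v + fderiv ℝ ψ x v) (v + fderiv ℝ ψ x v) +
        fderiv ℝ f (x + ψ x) (fderiv ℝ (fderiv ℝ ψ) x v v) -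
        fderiv ℝ f x (fderiv ℝ (fderiv ℝ ψ) x v v) := by
  have hf2 : ContDiffOn ℝ 2 f U := hf.of_le (by norm_num)
  set k : E → ℝ := fun y => fderiv ℝ f y v with hk_def
  have hk : ContDiffOn ℝ 2 k U :=
    (hf.fderiv_of_isOpen hU (by norm_num)).clm_apply contDiffOn_const
  have hfd : ∀ y ∈ U, HasFDerivAt f (fderiv ℝ f y) y := fun y hy =>
    ((hf2.differentiableOn (by norm_num)).differentiableAt (hU.mem_nhds hy)).hasFDerivAt
  have hψd : ∀ y ∈ U, HasFDerivAt ψ (fderiv ℝ ψ y) y := fun y hy =>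
    ((hψ.differentiableOn (by norm_num)).differentiableAt (hU.mem_nhds hy)).hasFDerivAt
  have hkd : HasFDerivAt k (fderiv ℝ k x) x :=
    ((hk.differentiableOn (by norm_num)).differentiableAt (hU.mem_nhds hx)).hasFDerivAt
  have hshift : ∀ y ∈ U, HasFDerivAt (fun y => y + ψ y) (.id ℝ E + fderiv ℝ ψ y) y :=
    fun y hy => (hasFDerivAt_id y).add (hψd y hy)
  have h1 : (fun y => fderiv ℝ (fun y => f (y + ψ y) - f y - fderiv ℝ f y (ψ y)) y v) =ᶠ[nhds x]
      fun y => fderiv ℝ f (y + ψ y) (v + fderiv ℝ ψ y v) - k y -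
        (fderiv ℝ k y (ψ y) + fderiv ℝ f y (fderiv ℝ ψ y v)) := by
    filter_upwards [hU.mem_nhds hx] with y hy
    refine (congrArg (fun L => L v) ((((hfd _ (hmaps y hy)).comp y (hshift y hy)).sub
      (hfd y hy)).sub ((hf2.hasFDerivAt_fderiv hU hy).clm_apply (hψd y hy))).fderiv).trans ?_
    simp only [hk_def, hf2.fderiv_fderiv_apply hU hy, hf2.fderiv_fderiv_comm hU hy (ψ y) v]
    simp
    ring
  have hψv : HasFDerivAt (fun y => fderiv ℝ ψ y v) (fderiv ℝ (fun y => fderiv ℝ ψ y v) x) x :=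
    ((hψ.hasFDerivAt_fderiv hU hx).clm_apply
      (hasFDerivAt_const v x)).differentiableAt.hasFDerivAt
  have h2 := ((((hf2.hasFDerivAt_fderiv hU (hmaps x hx)).comp x (hshift x hx)).clm_apply
    (hψv.const_add v)).sub hkd).sub
    (((hk.hasFDerivAt_fderiv hU hx).clm_apply (hψd x hx)).add
      ((hf2.hasFDerivAt_fderiv hU hx).clm_apply hψv))
  have hk0 : ∀ w, fderiv ℝ k x w = 0 := fun w => by
    rw [hk_def, hf2.fderiv_fderiv_apply hU hx]
    exact hconv.fderiv_fderiv_eq_zero hU hf2 hx hv w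
  have hsymm : fderiv ℝ (fderiv ℝ f) x v (fderiv ℝ ψ x v) = 0 := by
    rw [hf2.fderiv_fderiv_comm hU hx]
    exact hconv.fderiv_fderiv_eq_zero hU hf2 hx hv _
  have hk2 := hconv.fderiv_fderiv_fderiv_eq_zero hU hf hx hv (ψ x)
  rw [← hk_def] at hk2
  rw [h1.fderiv_eq]
  refine (congrArg (fun L => L v) h2.fderiv).trans ?_
  simp [hk0, hsymm, hk2, hψ.fderiv_fderiv_apply hU hx]
  ring

end SecondDerivative

theorem ContinuousOn.aestronglyMeasurable_comp_of_ae_mem {P : Type*} [TopologicalSpace P]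
    [MeasurableSpace P] [OpensMeasurableSpace P] [SecondCountableTopology P] {μ : Measure ℝ}
    {H : P → ℝ} {V : Set P} (hH : ContinuousOn H V) (hV : MeasurableSet V) {g : ℝ → P}
    (hg : Measurable g) (hgV : ∀ᵐ z ∂μ, g z ∈ V) :
    AEStronglyMeasurable (fun z => H (g z)) μ := by
  have h1 : AEStronglyMeasurable H ((μ.map g).restrict V) := hH.aestronglyMeasurable hV
  rw [Measure.restrict_eq_self_of_ae_mem ((ae_map_iff hg.aemeasurable hV).2 hgV)] at h1
  exact h1.comp_measurable hg

theorem norm_iteratedFDeriv_two {E F : Type*} [NormedAddCommGroup E] [NormedSpace ℝ E]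
    [NormedAddCommGroup F] [NormedSpace ℝ F] (g : E → F) (y : E) :
    ‖iteratedFDeriv ℝ 2 g y‖ = ‖fderiv ℝ (fderiv ℝ g) y‖ := by
  rw [← norm_iteratedFDeriv_fderiv, norm_iteratedFDeriv_one]

theorem exists_bound_fderiv_comp_prodMk {E F : Type*} [NormedAddCommGroup E] [NormedSpace ℝ E]
    [NormedAddCommGroup F] [NormedSpace ℝ F] {H : E × F → ℝ} {V K : Set (E × F)} {W : Set E}
    (hV : IsOpen V) (hH : ContDiffOn ℝ 2 H V) (hK : IsCompact K) (hKV : K ⊆ V)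
    (hW : IsOpen W) (L : ℝ) :
    ∃ C : ℝ, ∀ ψ : E → F, ContDiffOn ℝ 2 ψ W → (∀ y ∈ W, (y, ψ y) ∈ K) →
      (∀ y ∈ W, ‖fderiv ℝ ψ y‖ ≤ L ∧ ‖fderiv ℝ (fderiv ℝ ψ) y‖ ≤ L) →
      ∀ y ∈ W, ‖H (y, ψ y)‖ ≤ C ∧ ‖fderiv ℝ (fun y => H (y, ψ y)) y‖ ≤ C ∧
        ‖fderiv ℝ (fderiv ℝ fun y => H (y, ψ y)) y‖ ≤ C := by
  have hbd : ∀ i : ℕ, i ≤ 2 → ∃ C, ∀ p ∈ K, ‖iteratedFDerivWithin ℝ i H V p‖ ≤ C := fun i hi =>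
    hK.exists_bound_of_continuousOn
      ((hH.continuousOn_iteratedFDerivWithin (by exact_mod_cast hi) hV.uniqueDiffOn).mono hKV)
  obtain ⟨C₀, hC₀⟩ := hbd 0 (by norm_num)
  obtain ⟨C₁, hC₁⟩ := hbd 1 (by norm_num)
  obtain ⟨C₂, hC₂⟩ := hbd 2 le_rfl
  set C := max C₀ (max C₁ C₂) with hC
  set B := max 1 L with hB
  have hB1 : 1 ≤ B := le_max_left _ _
  have hCK : ∀ i : ℕ, i ≤ 2 → ∀ p ∈ K, ‖iteratedFDerivWithin ℝ i H V p‖ ≤ C := by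
    intro i hi p hp
    interval_cases i
    · exact (hC₀ p hp).trans (by simp [hC])
    · exact (hC₁ p hp).trans (by simp [hC])
    · exact (hC₂ p hp).trans (by simp [hC])
  refine ⟨max C (max (C * B) (2 * C * B ^ 2)), fun ψ hψ hψK hψL y hy => ?_⟩
  have hpair : ContDiffOn ℝ 2 (fun y => (y, ψ y)) W := contDiffOn_id.prodMk hψ
  have hD : ∀ i : ℕ, 1 ≤ i → i ≤ 2 →
      ‖iteratedFDerivWithin ℝ i (fun y => (y, ψ y)) W y‖ ≤ B ^ i := by
    intro i hi1 hi2
    rw [iteratedFDerivWithin_of_isOpen i hW hy]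
    have hprod := iteratedFDeriv_prodMk (𝕜 := ℝ) (n := 2) (i := i) (f := fun y : E => y) (g := ψ)
      contDiffAt_id (hψ.contDiffAt (hW.mem_nhds hy)) (by exact_mod_cast hi2)
    rw [hprod, ContinuousMultilinearMap.opNorm_prod]
    obtain ⟨h1, h2⟩ := hψL y hy
    interval_cases i
    · rw [norm_iteratedFDeriv_one, norm_iteratedFDeriv_one, fderiv_fun_id, pow_one]
      exact max_le_max ContinuousLinearMap.norm_id_le h1
    · have hid : fderiv ℝ (fun y : E => y) = fun _ => .id ℝ E := by ext1 z; exact fderiv_fun_id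
      rw [norm_iteratedFDeriv_two, norm_iteratedFDeriv_two, hid]
      have : L ≤ B := le_max_right _ _
      refine max_le ?_ ?_
      · simp; positivity
      · nlinarith
  have hcomp : ∀ i : ℕ, i ≤ 2 →
      ‖iteratedFDeriv ℝ i (fun y => H (y, ψ y)) y‖ ≤ (i.factorial : ℝ) * C * B ^ i := by
    intro i hi
    rw [← iteratedFDerivWithin_of_isOpen i hW hy]
    exact norm_iteratedFDerivWithin_comp_le (N := 2) hH hpair (by exact_mod_cast hi)
      hV.uniqueDiffOn hW.uniqueDiffOn (fun y hy => hKV (hψK y hy)) hy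
      (fun j hj => hCK j (hj.trans hi) _ (hψK y hy)) (fun j hj1 hj => hD j hj1 (hj.trans hi))
  have h0 := hcomp 0 (by norm_num)
  have h1 := hcomp 1 (by norm_num)
  have h2 := hcomp 2 le_rfl
  rw [norm_iteratedFDeriv_zero] at h0
  rw [norm_iteratedFDeriv_one] at h1
  rw [norm_iteratedFDeriv_two] at h2
  refine ⟨h0.trans ?_, h1.trans ?_, h2.trans ?_⟩ <;> simp

theorem norm_fderiv_fderiv_sub_le_norm_iteratedFDeriv_sub {E F : Type*} [NormedAddCommGroup E]
    [NormedSpace ℝ E] [NormedAddCommGroup F] [NormedSpace ℝ F] (g : E → F) (x y : E) :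
    ‖fderiv ℝ (fderiv ℝ g) y - fderiv ℝ (fderiv ℝ g) x‖ ≤
      ‖iteratedFDeriv ℝ 2 g y - iteratedFDeriv ℝ 2 g x‖ := by
  refine ContinuousLinearMap.opNorm_le_bound₂ _ (norm_nonneg _) fun h k => ?_
  have := (iteratedFDeriv ℝ 2 g y - iteratedFDeriv ℝ 2 g x).le_opNorm ![h, k]
  simpa [iteratedFDeriv_two_apply, Fin.prod_univ_two, mul_assoc] using this

theorem JumpKernel.add_mem_posOrth {n : ℕ} {T : ℝ} (K : JumpKernel n T) {y : Fin n → ℝ}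
    (hy : y ∈ posOrth n) {t : ℝ} (ht : t ∈ Icc (0 : ℝ) T) {z : ℝ} (hz : z ∈ Icc (0 : ℝ) 1) :
    y + K.φ y t z ∈ posOrth n := by
  obtain ⟨γ, hγ, hlow⟩ := K.lower
  intro i
  have h1 := hlow y hy t ht z hz i
  have h2 := hy i
  simp only [Pi.add_apply]
  nlinarith

/-- Locally uniform bounds, over the jump marks `z ∈ [0,1]`, for the jump sizes and their first two
derivatives. -/
theorem JumpKernel.exists_uniform_bounds {n : ℕ} {T : ℝ} (K : JumpKernel n T)
    {x : Fin n → ℝ} (hx : x ∈ posOrth n) {t : ℝ} (ht : t ∈ Icc (0 : ℝ) T) :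
    ∃ r > 0, Metric.closedBall x r ⊆ posOrth n ∧ ∃ M L : ℝ, ∀ z ∈ Icc (0 : ℝ) 1,
      ∀ y ∈ Metric.ball x r, ‖K.φ y t z‖ ≤ M ∧ ‖fderiv ℝ (fun y => K.φ y t z) y‖ ≤ L ∧
        ‖fderiv ℝ (fderiv ℝ fun y => K.φ y t z) y‖ ≤ L := by
  obtain ⟨α, hα, -, hhol⟩ := K.holder2
  obtain ⟨s, hs, hsU, C, hC⟩ := hhol t ht x hx
  obtain ⟨D, hD, hbound⟩ := K.bound
  obtain ⟨R, hR, hRs⟩ := Metric.mem_nhds_iff.1 hs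
  have hball : Metric.ball x R ⊆ posOrth n := hRs.trans hsU
  have hM : ∀ z ∈ Icc (0 : ℝ) 1, ∀ y ∈ Metric.ball x R,
      ‖K.φ y t z‖ ≤ √D * (‖x‖ + R) := by
    intro z hz y hy
    refine (pi_norm_le_iff_of_nonneg (by positivity)).2 fun i => ?_
    have hyi : ‖y‖ ≤ ‖x‖ + R := by
      rw [Metric.mem_ball, dist_eq_norm] at hy
      linarith [norm_le_norm_add_norm_sub' y x]
    calc ‖K.φ y t z i‖ ≤ √(D * y i ^ 2) := Real.abs_le_sqrt (hbound y (hball hy) t ht z hz i)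
      _ = √D * ‖y i‖ := by rw [Real.sqrt_mul hD.le, Real.sqrt_sq_eq_abs, Real.norm_eq_abs]
      _ ≤ √D * (‖x‖ + R) := by gcongr; exact (norm_le_pi_norm y i).trans hyi
  obtain ⟨L, hL⟩ := fderiv_bounds_of_oscillation (E := Fin n → ℝ) (F := Fin n → ℝ) (x := x) hR
    (C * R ^ (α : ℝ)) (√D * (‖x‖ + R))
  have hsub : Metric.ball x (R / 2) ⊆ Metric.ball x R := Metric.ball_subset_ball (by linarith)
  refine ⟨R / 2, by positivity, (Metric.closedBall_subset_ball (by linarith)).trans hball, _, L,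
    fun z hz y hy => ⟨hM z hz y (hsub hy), hL _ ((K.smooth t ht z hz).mono hball)
      (hM z hz) (fun w hw => ?_) y hy⟩⟩
  refine (norm_fderiv_fderiv_sub_le_norm_iteratedFDeriv_sub _ _ _).trans ?_
  rw [← dist_eq_norm]
  refine ((hC z hz).dist_le (hRs hw) (hRs (Metric.mem_ball_self hR))).trans ?_
  gcongr
  exact (Metric.mem_ball.1 hw).le

/-- If in addition `f` is convex and `∂_v²f(x) = 0`, then the formula for `∂_v²(Bf)(x,t)`
simplifies to `λ(t)` times the integral of the (ohly) integrand:
`∂_v²(Bf)(x,t) = λ(t) ∫₀¹ ( f_vv(x+φ) + 2 φ_v·∇f_v(x+φ) + φ_vᵀ Hf(x+φ) φ_v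
+ φ_vv·(∇f(x+φ) − ∇f(x)) ) dz`. -/
theorem dir2_Bop_eq_of_convex {n : ℕ} {T : ℝ} (hT : 0 < T)
    (K : JumpKernel n T) (lam : ℝ → ℝ) (hlam : LamOK T lam)
    (f : (Fin n → ℝ) → ℝ) (hf : MemTestClass n f)
    (hconv : ConvexOn ℝ (posOrth n) f)
    (x : Fin n → ℝ) (hx : x ∈ posOrth n)
    (t : ℝ) (ht : t ∈ Set.Icc (0:ℝ) T)
    (v : Fin n → ℝ) (hv : v ≠ 0)
    (hvv : dir2 f x v = 0) :
    dir2 (fun y => Bop lam K f y t) x v =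
      lam t * ∫ z in Icc (0:ℝ) 1, ohlyIntegrand K f x v t z := by
  have hU := isOpen_posOrth n
  have hf3 : ContDiffOn ℝ 3 f (posOrth n) := hf.smooth.of_le (by norm_num)
  have hf2 : ContDiffOn ℝ 2 f (posOrth n) := hf.smooth.of_le (by norm_num)
  obtain ⟨r, hr, hrU, M, L, hML⟩ := K.exists_uniform_bounds hx ht
  obtain ⟨γ, hγ, hlow⟩ := K.lower
  set W := Metric.ball x r with hW_def
  have hWU : W ⊆ posOrth n := Metric.ball_subset_closedBall.trans hrU
  have hxW : x ∈ W := Metric.mem_ball_self hr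
  set V : Set ((Fin n → ℝ) × (Fin n → ℝ)) :=
    {p | p.1 ∈ posOrth n ∧ p.1 + p.2 ∈ posOrth n} with hV_def
  have hV : IsOpen V :=
    (hU.preimage continuous_fst).inter (hU.preimage (continuous_fst.add continuous_snd))
  set S : Set ((Fin n → ℝ) × (Fin n → ℝ)) :=
    (Metric.closedBall x r ×ˢ Metric.closedBall 0 M) ∩ {p | ∀ i, γ * p.1 i ≤ p.2 i} with hS_def
  have hS : IsCompact S := by
    refine ((isCompact_closedBall x r).prod (isCompact_closedBall 0 M)).inter_right ?_
    simp only [ofPred_forall]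
    exact isClosed_iInter fun i => isClosed_le (by fun_prop) (by fun_prop)
  have hSV : S ⊆ V := by
    rintro ⟨y, p⟩ ⟨⟨hy, -⟩, hp⟩
    refine ⟨hrU hy, fun i => ?_⟩
    have h1 := hp i
    have h2 := hrU hy i
    simp only [Pi.add_apply] at h1 ⊢
    nlinarith
  set H : (Fin n → ℝ) × (Fin n → ℝ) → ℝ :=
    fun p => f (p.1 + p.2) - f p.1 - fderiv ℝ f p.1 p.2 with hH_def
  have hH : ContDiffOn ℝ 2 H V := by
    refine ((hf2.comp (contDiffOn_fst.add contDiffOn_snd) fun p hp => hp.2).sub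
      (hf2.comp contDiffOn_fst fun p hp => hp.1)).sub ?_
    exact ((hf3.fderiv_of_isOpen hU (m := 2) (by norm_num)).comp contDiffOn_fst
      fun p hp => hp.1).clm_apply contDiffOn_snd
  have hφ : ∀ z ∈ Icc (0 : ℝ) 1, ContDiffOn ℝ 2 (fun y => K.φ y t z) (posOrth n) :=
    K.smooth t ht
  have hmemS : ∀ z ∈ Icc (0 : ℝ) 1, ∀ y ∈ W, (y, K.φ y t z) ∈ S := fun z hz y hy =>
    ⟨⟨Metric.ball_subset_closedBall hy, by simpa using (hML z hz y hy).1⟩,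
      fun i => (hlow y (hWU hy) t ht z hz i).le⟩
  obtain ⟨C, hC⟩ := exists_bound_fderiv_comp_prodMk hV hH hS hSV (Metric.isOpen_ball (x := x)
    (ε := r)) L
  set G : (Fin n → ℝ) → ℝ → ℝ := fun y z => H (y, K.φ y t z) with hG_def
  have hGC := fun z hz => hC (fun y => K.φ y t z) ((hφ z hz).mono hWU) (hmemS z hz)
    fun y hy => (hML z hz y hy).2
  have hGsmooth : ∀ z ∈ Icc (0 : ℝ) 1, ContDiffOn ℝ 2 (fun y => G y z) W := fun z hz =>
    hH.comp (contDiffOn_id.prodMk ((hφ z hz).mono hWU)) fun y hy => hSV (hmemS z hz y hy)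
  set μ : Measure ℝ := volume.restrict (Icc (0 : ℝ) 1) with hμ
  have hae : ∀ {p : ℝ → Prop}, (∀ z ∈ Icc (0 : ℝ) 1, p z) → ∀ᵐ z ∂μ, p z := fun h =>
    (ae_restrict_iff' measurableSet_Icc).2 (Filter.Eventually.of_forall h)
  have hint : ∀ y ∈ W, Integrable (G y) μ := fun y hy =>
    Integrable.of_bound (hH.continuousOn.aestronglyMeasurable_comp_of_ae_mem hV.measurableSet
      (measurable_const.prodMk (K.meas y (hWU hy) t ht)) (hae fun z hz => hSV (hmemS z hz y hy)))
      C (hae fun z hz => (hGC z hz y hy).1)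
  have hfirst := fun {y} (hy : y ∈ W) => fderiv_integral_apply Metric.isOpen_ball hint
    (hae fun z hz y hy => ((hGsmooth z hz).differentiableOn (by norm_num)).differentiableAt
      (Metric.isOpen_ball.mem_nhds hy)) (hae fun z hz y hy => (hGC z hz y hy).2.1) hy v
  have hsecond := fderiv_integral_apply (G := fun y z => fderiv ℝ (fun y => G y z) y v)
    (C := C * ‖v‖) Metric.isOpen_ball (fun y hy => (hfirst hy).1)
    (hae fun z hz y hy => (((hGsmooth z hz).hasFDerivAt_fderiv Metric.isOpen_ball hy).clm_apply
      (hasFDerivAt_const v y)).differentiableAt)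
    (hae fun z hz y hy => by
      refine ContinuousLinearMap.opNorm_le_bound _
        (mul_nonneg ((norm_nonneg _).trans (hGC z hz y hy).1) (norm_nonneg v)) fun w => ?_
      rw [(hGsmooth z hz).fderiv_fderiv_apply Metric.isOpen_ball hy]
      calc _ ≤ ‖fderiv ℝ (fderiv ℝ fun y => G y z) y‖ * ‖w‖ * ‖v‖ :=
            ContinuousLinearMap.le_opNorm₂ _ _ _
        _ ≤ C * ‖w‖ * ‖v‖ := by gcongr; exact (hGC z hz y hy).2.2
        _ = C * ‖v‖ * ‖w‖ := by ring) hxW v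
  have hvv' : fderiv ℝ (fderiv ℝ f) x v v = 0 := by
    rw [← hf2.fderiv_fderiv_apply hU hx]
    exact hvv
  have hpoint : ∀ z ∈ Icc (0 : ℝ) 1,
      fderiv ℝ (fun y => fderiv ℝ (fun y => G y z) y v) x v = ohlyIntegrand K f x v t z := by
    intro z hz
    have hxφ := K.add_mem_posOrth hx ht hz
    refine (hconv.fderiv_fderiv_taylor_remainder hU hf3 (hφ z hz)
      (fun y hy => K.add_mem_posOrth hy ht hz) hx hvv').trans ?_
    simp only [ohlyIntegrand, dmix, dir1, dir2, hf2.fderiv_fderiv_apply hU hxφ,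
      (hφ z hz).fderiv_fderiv_apply hU hx, map_add, _root_.add_apply]
    rw [hf2.fderiv_fderiv_comm hU hxφ v (fderiv ℝ (fun y => K.φ y t z) x v)]
    ring
  have hB : (fun y => Bop lam K f y t) = lam t • fun y => ∫ z, G y z ∂μ := rfl
  have hB1 : (fun y => fderiv ℝ (fun y => Bop lam K f y t) y v) =ᶠ[nhds x]
      lam t • fun y => ∫ z, fderiv ℝ (fun y => G y z) y v ∂μ := by
    filter_upwards [Metric.isOpen_ball.mem_nhds hxW] with y hy
    rw [hB, fderiv_const_smul_field]
    simp [(hfirst hy).2]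
  rw [dir2, dmix, hB1.fderiv_eq, fderiv_const_smul_field]
  simp only [Pi.smul_apply, _root_.smul_apply, smul_eq_mul, hsecond.2]
  rw [setIntegral_congr_fun measurableSet_Icc hpoint]

end
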